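/- arXiv:2401.02346 — 4 statements merged into one kernel-verified Lean document; each statement's English description precedes it below -/
import Mathlib

section
/- Let a, b ∈ ℂ with 4a³ + 27b² ≠ 0, and let P₁ = (x₁,y₁), P₂ = (x₂,y₂), P₃ = (x₃,y₃) be points of ℂ² satisfying yᵢ² = xᵢ³ + a·xᵢ + b for i = 1,2,3. Assume x₁ ≠ x₂ and x₂ ≠ x₃, let (x̃,ỹ) := P₁ + P₂ (chord formula) and assume x̃ ≠ x₃, and let (x̂,ŷ) := P₂ + P₃ (chord formula) and assume x̂ ≠ x₁. Then (P₁ + P₂) + P₃ = P₁ + (P₂ + P₃), where all four additions are given by the chord formula; i.e., the two resulting points of ℂ² have equal coordinates. -/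
/-- Addition of two points on an elliptic curve by the chord formula:
for `P = (x₁,y₁)` and `Q = (x₂,y₂)` with `x₁ ≠ x₂`, with slope
`α = (y₂ − y₁)/(x₂ − x₁)`, the sum is `(x', y')` where
`x' = −x₁ − x₂ + α²` and `y' = −y₁ − α·(x' − x₁)`. -/
noncomputable def chordAdd (P Q : ℂ × ℂ) : ℂ × ℂ :=
  let α : ℂ := (Q.2 - P.2) / (Q.1 - P.1)
  let x' : ℂ := -P.1 - Q.1 + α ^ 2
  (x', -P.2 - α * (x' - P.1))

open Classical in
theorem chordAdd_point (a b : ℂ) (P Q : ℂ × ℂ)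
    (hP : (WeierstrassCurve.mk 0 0 0 a b).toAffine.Nonsingular P.1 P.2)
    (hQ : (WeierstrassCurve.mk 0 0 0 a b).toAffine.Nonsingular Q.1 Q.2)
    (hx : P.1 ≠ Q.1) :
    ∃ h : (WeierstrassCurve.mk 0 0 0 a b).toAffine.Nonsingular (chordAdd P Q).1 (chordAdd P Q).2,
      WeierstrassCurve.Affine.Point.some _ _ hP + WeierstrassCurve.Affine.Point.some _ _ hQ
        = WeierstrassCurve.Affine.Point.some _ _ h := by
  have hs : (WeierstrassCurve.mk 0 0 0 a b).toAffine.slope P.1 Q.1 P.2 Q.2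
      = (Q.2 - P.2) / (Q.1 - P.1) := by
    rw [WeierstrassCurve.Affine.slope_of_X_ne hx, ← neg_sub Q.2, ← neg_sub Q.1, neg_div_neg_eq]
  have e1 : (WeierstrassCurve.mk 0 0 0 a b).toAffine.addX P.1 Q.1
      ((WeierstrassCurve.mk 0 0 0 a b).toAffine.slope P.1 Q.1 P.2 Q.2) = (chordAdd P Q).1 := by
    rw [hs]
    simp only [WeierstrassCurve.Affine.addX, chordAdd]
    ring
  have e2 : (WeierstrassCurve.mk 0 0 0 a b).toAffine.addY P.1 Q.1 P.2
      ((WeierstrassCurve.mk 0 0 0 a b).toAffine.slope P.1 Q.1 P.2 Q.2) = (chordAdd P Q).2 := by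
    rw [hs]
    simp only [WeierstrassCurve.Affine.addY, WeierstrassCurve.Affine.negY,
      WeierstrassCurve.Affine.negAddY, WeierstrassCurve.Affine.addX, chordAdd]
    ring
  have hn := WeierstrassCurve.Affine.nonsingular_add hP hQ (fun hxy => hx hxy.left)
  refine ⟨by rw [← e1, ← e2]; exact hn, ?_⟩
  rw [WeierstrassCurve.Affine.Point.add_of_X_ne hx, WeierstrassCurve.Affine.Point.some.injEq]
  exact ⟨e1, e2⟩

theorem chordAdd_assoc (a b x₁ y₁ x₂ y₂ x₃ y₃ : ℂ)
    (hdisc : 4 * a ^ 3 + 27 * b ^ 2 ≠ 0)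
    (h₁ : y₁ ^ 2 = x₁ ^ 3 + a * x₁ + b)
    (h₂ : y₂ ^ 2 = x₂ ^ 3 + a * x₂ + b)
    (h₃ : y₃ ^ 2 = x₃ ^ 3 + a * x₃ + b)
    (h₁₂ : x₁ ≠ x₂) (h₂₃ : x₂ ≠ x₃)
    (hL : (chordAdd (x₁, y₁) (x₂, y₂)).1 ≠ x₃)
    (hR : (chordAdd (x₂, y₂) (x₃, y₃)).1 ≠ x₁) :
    chordAdd (chordAdd (x₁, y₁) (x₂, y₂)) (x₃, y₃)
      = chordAdd (x₁, y₁) (chordAdd (x₂, y₂) (x₃, y₃)) := by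
  classical
  have hΔ : (WeierstrassCurve.mk 0 0 0 a b).toAffine.Δ ≠ 0 := by
    intro h
    apply hdisc
    simp only [WeierstrassCurve.Δ, WeierstrassCurve.b₂, WeierstrassCurve.b₄,
      WeierstrassCurve.b₆, WeierstrassCurve.b₈] at h
    linear_combination (-1 / 16) * h
  have ns : ∀ x y : ℂ, y ^ 2 = x ^ 3 + a * x + b →
      (WeierstrassCurve.mk 0 0 0 a b).toAffine.Nonsingular x y := by
    intro x y h
    rw [← WeierstrassCurve.Affine.equation_iff_nonsingular_of_Δ_ne_zero hΔ,
      WeierstrassCurve.Affine.equation_iff]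
    linear_combination h
  obtain ⟨n12, e12⟩ := chordAdd_point a b (x₁, y₁) (x₂, y₂) (ns _ _ h₁) (ns _ _ h₂) h₁₂
  obtain ⟨n23, e23⟩ := chordAdd_point a b (x₂, y₂) (x₃, y₃) (ns _ _ h₂) (ns _ _ h₃) h₂₃
  obtain ⟨nL, eL⟩ := chordAdd_point a b _ (x₃, y₃) n12 (ns _ _ h₃) hL
  obtain ⟨nR, eR⟩ := chordAdd_point a b (x₁, y₁) _ (ns _ _ h₁) n23 hR.symm
  have key := eL
  rw [← e12, add_assoc, e23, eR, WeierstrassCurve.Affine.Point.some.injEq] at key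
  exact (Prod.ext key.1 key.2).symm
end

section
/- Let a, b ∈ ℂ with 4a³ + 27b² ≠ 0, and let P₁ = (x₁,y₁), P₂ = (x₂,y₂), P₃ = (x₃,y₃) be points of ℂ² satisfying yᵢ² = xᵢ³ + a·xᵢ + b for i = 1,2,3, with x₁, x₂, x₃ pairwise distinct. Let (x̃,ỹ) := P₁ + P₂ (chord formula) and assume x̃ ≠ x₃, and let (x₄,y₄) := (P₁ + P₂) + P₃ (chord formula). Then x₄ = −x₁ − x₂ − x₃ + (V² − 2c₁c₂)/c₂² and y₄ = −(c₂x₄² + c₁x₄ + c₀)/V, where in particular c₂ ≠ 0 and V ≠ 0. -/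
theorem explicit_formula_for_triple_sum (a b x₁ y₁ x₂ y₂ x₃ y₃ : ℂ)
    (hdisc : 4 * a ^ 3 + 27 * b ^ 2 ≠ 0)
    (h₁ : y₁ ^ 2 = x₁ ^ 3 + a * x₁ + b)
    (h₂ : y₂ ^ 2 = x₂ ^ 3 + a * x₂ + b)
    (h₃ : y₃ ^ 2 = x₃ ^ 3 + a * x₃ + b)
    (h₁₂ : x₁ ≠ x₂) (h₂₃ : x₂ ≠ x₃) (h₃₁ : x₃ ≠ x₁)
    (hL : (chordAdd (x₁, y₁) (x₂, y₂)).1 ≠ x₃) :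
    let V : ℂ := (x₁ - x₂) * (x₂ - x₃) * (x₃ - x₁)
    let c₀ : ℂ := Matrix.det !![x₁, x₁ ^ 2, y₁; x₂, x₂ ^ 2, y₂; x₃, x₃ ^ 2, y₃]
    let c₁ : ℂ := -Matrix.det !![1, x₁ ^ 2, y₁; 1, x₂ ^ 2, y₂; 1, x₃ ^ 2, y₃]
    let c₂ : ℂ := Matrix.det !![1, x₁, y₁; 1, x₂, y₂; 1, x₃, y₃]
    let x₄ : ℂ := (chordAdd (chordAdd (x₁, y₁) (x₂, y₂)) (x₃, y₃)).1
    let y₄ : ℂ := (chordAdd (chordAdd (x₁, y₁) (x₂, y₂)) (x₃, y₃)).2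
    c₂ ≠ 0 ∧ V ≠ 0 ∧
      x₄ = -x₁ - x₂ - x₃ + (V ^ 2 - 2 * c₁ * c₂) / c₂ ^ 2 ∧
      y₄ = -(c₂ * x₄ ^ 2 + c₁ * x₄ + c₀) / V := by
  intro V c₀ c₁ c₂ x₄ y₄
  have d21 : x₂ - x₁ ≠ 0 := sub_ne_zero.mpr h₁₂.symm
  have d31 : x₃ - x₁ ≠ 0 := sub_ne_zero.mpr h₃₁
  have d32 : x₃ - x₂ ≠ 0 := sub_ne_zero.mpr h₂₃.symm
  obtain ⟨α, hα⟩ : ∃ α, α = (y₂ - y₁) / (x₂ - x₁) := ⟨_, rfl⟩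
  obtain ⟨A, hA⟩ : ∃ A, A = (y₃ - (y₁ + α * (x₃ - x₁))) / ((x₃ - x₁) * (x₃ - x₂)) := ⟨_, rfl⟩
  have e2 : y₂ = y₁ + α * (x₂ - x₁) := by rw [hα]; field_simp; ring
  have e3 : y₃ = y₁ + α * (x₃ - x₁) + A * ((x₃ - x₁) * (x₃ - x₂)) := by
    rw [hA]; field_simp; ring
  obtain ⟨X, hX⟩ : ∃ X, X = -x₁ - x₂ + α ^ 2 := ⟨_, rfl⟩
  have hsum : chordAdd (x₁, y₁) (x₂, y₂) = (X, -y₁ - α * (X - x₁)) := by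
    simp only [chordAdd, hX, hα]
  rw [hsum] at hL
  have dX : x₃ - X ≠ 0 := sub_ne_zero.mpr (Ne.symm hL)
  have ha : α * (2 * y₁ + α * (x₂ - x₁)) = x₁ ^ 2 + x₁ * x₂ + x₂ ^ 2 + a := by
    apply mul_left_cancel₀ d21
    rw [e2] at h₂
    linear_combination h₂ - h₁
  have hR : A * (2 * (y₁ + α * (x₃ - x₁)) + A * ((x₃ - x₁) * (x₃ - x₂))) = x₃ - X := by
    apply mul_left_cancel₀ (mul_ne_zero d31 d32)
    rw [e3] at h₃
    rw [hX]
    linear_combination h₃ - h₁ - (x₃ - x₁) * ha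
  have hA0 : A ≠ 0 := by
    rintro h
    rw [h] at hR
    exact dX (by rw [← hR]; ring)
  have hV : V ≠ 0 := mul_ne_zero (mul_ne_zero (sub_ne_zero.mpr h₁₂) (sub_ne_zero.mpr h₂₃)) d31
  have hc2 : c₂ = A * V := by
    simp [c₂, V, Matrix.det_fin_three]; rw [e3, e2]; ring
  have hc1 : c₁ = (α - A * (x₁ + x₂)) * V := by
    simp [c₁, V, Matrix.det_fin_three]; rw [e3, e2]; ring
  have hc0 : c₀ = (y₁ - α * x₁ + A * (x₁ * x₂)) * V := by
    simp [c₀, V, Matrix.det_fin_three]; rw [e3, e2]; ring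
  have hβ : (y₃ - (-y₁ - α * (X - x₁))) / (x₃ - X) = 1 / A - α := by
    rw [div_eq_iff dX]
    field_simp
    rw [e3]
    linear_combination hR
  have hx4 : x₄ = -X - x₃ + (1 / A - α) ^ 2 := by
    simp only [x₄, hsum]
    rw [← hβ]
    simp only [chordAdd]
  have hy4 : y₄ = -(-y₁ - α * (X - x₁)) - (1 / A - α) * (x₄ - X) := by
    rw [hx4]
    simp only [y₄, hsum]
    rw [← hβ]
    simp only [chordAdd]
  have hS : A * (2 * α + A * (x₄ + x₃ - x₁ - x₂)) = 1 := by
    rw [hx4, hX]; field_simp; ring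
  clear_value V c₀ c₁ c₂ x₄ y₄
  refine ⟨by rw [hc2]; exact mul_ne_zero hA0 hV, hV, ?_, ?_⟩
  · rw [hx4, hc2, hc1, hX]; field_simp; ring
  · have : -(c₂ * x₄ ^ 2 + c₁ * x₄ + c₀) / V
        = -(y₁ + α * (x₄ - x₁) + A * ((x₄ - x₁) * (x₄ - x₂))) := by
      rw [hc2, hc1, hc0]; field_simp; ring
    rw [this, hy4]
    apply mul_left_cancel₀ hA0
    have h1 : A * (1 / A) = 1 := by field_simp
    linear_combination hR + (x₄ - x₃) * hS - (x₄ - X) * h1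
end

section
/- Let a, b ∈ ℂ with 4a³ + 27b² ≠ 0, and let P₁ = (x₁,y₁), P₂ = (x₂,y₂), P₃ = (x₃,y₃) be points of ℂ² satisfying yᵢ² = xᵢ³ + a·xᵢ + b for i = 1,2,3, with x₁, x₂, x₃ pairwise distinct. Let (x̃,ỹ) := P₁ + P₂ (chord formula) and assume x̃ ≠ x₃. Set α := (y₂ − y₁)/(x₂ − x₁) and α̃ := (y₃ − ỹ)/(x₃ − x̃). Then c₂ ≠ 0 and α + α̃ = V/c₂. -/
theorem slope_sum_lemma (a b x₁ y₁ x₂ y₂ x₃ y₃ : ℂ)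
    (hdisc : 4 * a ^ 3 + 27 * b ^ 2 ≠ 0)
    (h₁ : y₁ ^ 2 = x₁ ^ 3 + a * x₁ + b)
    (h₂ : y₂ ^ 2 = x₂ ^ 3 + a * x₂ + b)
    (h₃ : y₃ ^ 2 = x₃ ^ 3 + a * x₃ + b)
    (h₁₂ : x₁ ≠ x₂) (h₂₃ : x₂ ≠ x₃) (h₃₁ : x₃ ≠ x₁)
    (hL : (chordAdd (x₁, y₁) (x₂, y₂)).1 ≠ x₃) :
    let V : ℂ := (x₁ - x₂) * (x₂ - x₃) * (x₃ - x₁)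
    let c₂ : ℂ := Matrix.det !![1, x₁, y₁; 1, x₂, y₂; 1, x₃, y₃]
    let α : ℂ := (y₂ - y₁) / (x₂ - x₁)
    let x' : ℂ := (chordAdd (x₁, y₁) (x₂, y₂)).1
    let y' : ℂ := (chordAdd (x₁, y₁) (x₂, y₂)).2
    let α' : ℂ := (y₃ - y') / (x₃ - x')
    c₂ ≠ 0 ∧ α + α' = V / c₂ := by
  intro V c₂ α x' y' α'
  have hd : x₂ - x₁ ≠ 0 := sub_ne_zero.mpr (Ne.symm h₁₂)
  have hα : α * (x₂ - x₁) = y₂ - y₁ := div_mul_cancel₀ _ hd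
  have hx : x' = -x₁ - x₂ + α ^ 2 := rfl
  have hy : y' = -y₁ - α * (x' - x₁) := rfl
  have hc : c₂ = (x₂ - x₁) * (y₃ - (y₁ + α * (x₃ - x₁))) := by
    have : c₂ = (x₂ - x₁) * (y₃ - y₁) - (x₃ - x₁) * (y₂ - y₁) := by
      simp only [c₂, Matrix.det_fin_three]
      simp
      ring
    rw [this]
    linear_combination (x₃ - x₁) * hα
  have hV : V = (x₁ - x₂) * (x₂ - x₃) * (x₃ - x₁) := rfl
  have hL' : x₃ - x' ≠ 0 := sub_ne_zero.mpr (Ne.symm hL)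
  have hα' : α' * (x₃ - x') = y₃ - y' := div_mul_cancel₀ _ hL'
  clear_value V c₂ α x' y' α'
  have hk : α * (2 * y₁ + α * (x₂ - x₁)) = x₁ ^ 2 + x₁ * x₂ + x₂ ^ 2 + a := by
    apply mul_left_cancel₀ hd
    have e : y₂ = y₁ + α * (x₂ - x₁) := by linear_combination -hα
    rw [e] at h₂
    linear_combination h₂ - h₁
  have key : (y₃ - (y₁ + α * (x₃ - x₁))) * (y₃ + (y₁ + α * (x₃ - x₁)))
      = (x₃ - x₁) * (x₃ - x₂) * (x₃ - x') := by
    rw [hx]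
    linear_combination h₃ - h₁ - (x₃ - x₁) * hk
  have hne : y₃ - (y₁ + α * (x₃ - x₁)) ≠ 0 := by
    intro h
    rw [h, zero_mul] at key
    exact mul_ne_zero (mul_ne_zero (sub_ne_zero.mpr h₃₁) (sub_ne_zero.mpr (Ne.symm h₂₃))) hL' key.symm
  have hc0 : c₂ ≠ 0 := hc ▸ mul_ne_zero hd hne
  refine ⟨hc0, ?_⟩
  rw [eq_div_iff hc0]
  apply mul_right_cancel₀ hL'
  have hs : (α + α') * (x₃ - x') = y₃ + (y₁ + α * (x₃ - x₁)) := by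
    linear_combination hα' - hy
  rw [hc, hV]
  linear_combination (x₂ - x₁) * (y₃ - (y₁ + α * (x₃ - x₁))) * hs + (x₂ - x₁) * key
end

section
/- Let a, b ∈ ℂ with 4a³ + 27b² ≠ 0, and let P₁ = (x₁,y₁), P₂ = (x₂,y₂), P₃ = (x₃,y₃) be points of ℂ² satisfying yᵢ² = xᵢ³ + a·xᵢ + b for i = 1,2,3, with x₁, x₂, x₃ pairwise distinct. Let (x̃,ỹ) := P₁ + P₂ (chord formula), assume x̃ ≠ x₃, and let (x₄,y₄) := (P₁ + P₂) + P₃ (chord formula). Then the determinant of the 4×4 matrix with rows (1, x₁, x₁², y₁), (1, x₂, x₂², y₂), (1, x₃, x₃², y₃), (1, x₄, x₄², −y₄) vanishes; equivalently, the point (x₄, −y₄) = −P₄ lies on the unique parabola y = α₀ + α₁x + α₂x² through P₁, P₂, P₃. -/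
theorem parabola_det_vanishes (a b x₁ y₁ x₂ y₂ x₃ y₃ : ℂ)
    (hdisc : 4 * a ^ 3 + 27 * b ^ 2 ≠ 0)
    (h₁ : y₁ ^ 2 = x₁ ^ 3 + a * x₁ + b)
    (h₂ : y₂ ^ 2 = x₂ ^ 3 + a * x₂ + b)
    (h₃ : y₃ ^ 2 = x₃ ^ 3 + a * x₃ + b)
    (h₁₂ : x₁ ≠ x₂) (h₂₃ : x₂ ≠ x₃) (h₃₁ : x₃ ≠ x₁)
    (hL : (chordAdd (x₁, y₁) (x₂, y₂)).1 ≠ x₃) :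
    let x₄ : ℂ := (chordAdd (chordAdd (x₁, y₁) (x₂, y₂)) (x₃, y₃)).1
    let y₄ : ℂ := (chordAdd (chordAdd (x₁, y₁) (x₂, y₂)) (x₃, y₃)).2
    Matrix.det !![1, x₁, x₁ ^ 2, y₁;
                  1, x₂, x₂ ^ 2, y₂;
                  1, x₃, x₃ ^ 2, y₃;
                  1, x₄, x₄ ^ 2, -y₄] = 0 := by
  have d12 : x₂ - x₁ ≠ 0 := sub_ne_zero.mpr h₁₂.symm
  simp only [chordAdd] at hL ⊢
  generalize hα : (y₂ - y₁) / (x₂ - x₁) = α at *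
  have e2 : y₂ = y₁ + α * (x₂ - x₁) := by
    rw [← hα]; field_simp; ring
  generalize hxt : -x₁ - x₂ + α ^ 2 = xt at *
  generalize hyt : -y₁ - α * (xt - x₁) = yt at *
  have d3 : x₃ - xt ≠ 0 := sub_ne_zero.mpr hL.symm
  generalize hβ : (y₃ - yt) / (x₃ - xt) = β at *
  have e3 : y₃ = yt + β * (x₃ - xt) := by
    rw [← hβ]; field_simp; ring
  generalize hx4 : -xt - x₃ + β ^ 2 = x₄ at *
  have ha : a = α * (y₁ + y₂) - (x₁ ^ 2 + x₁ * x₂ + x₂ ^ 2) := by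
    apply mul_left_cancel₀ d12
    linear_combination h₁ - h₂ + (y₁ + y₂) * e2
  have hb : b = y₁ ^ 2 - x₁ ^ 3 - a * x₁ := by linear_combination -h₁
  -- the third point lies on the parabola
  have p3 : (α + β) * (y₃ - (y₁ + α * (x₃ - x₁))) = (x₃ - x₁) * (x₃ - x₂) := by
    apply mul_left_cancel₀ d3
    have q : y₃ ^ 2 = (y₁ + α * (x₃ - x₁)) ^ 2 + (x₃ - x₁) * (x₃ - x₂) * (x₃ - xt) := by
      rw [h₃, hb, ha, e2, ← hxt]; ring
    have r : (α + β) * (x₃ - xt) = y₃ + (y₁ + α * (x₃ - x₁)) := by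
      rw [e3, ← hyt]; ring
    linear_combination (y₃ - (y₁ + α * (x₃ - x₁))) * r + q
  have hs : α + β ≠ 0 := by
    intro h
    rw [h, zero_mul] at p3
    exact mul_ne_zero (sub_ne_zero.mpr h₃₁) (sub_ne_zero.mpr h₂₃.symm) p3.symm
  have p4 : (α + β) * (yt + β * (x₄ - xt) - (y₁ + α * (x₄ - x₁))) = (x₄ - x₁) * (x₄ - x₂) := by
    have k : α ^ 2 - β ^ 2 = x₁ + x₂ - x₃ - x₄ := by linear_combination hxt - hx4
    linear_combination p3 - (α + β) * e3 - (x₄ - x₃) * k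
  have f3 : y₃ = y₁ + α * (x₃ - x₁) + (x₃ - x₁) * (x₃ - x₂) / (α + β) := by
    rw [← p3]; field_simp; ring
  have f4 : -(-yt - β * (x₄ - xt)) = y₁ + α * (x₄ - x₁) + (x₄ - x₁) * (x₄ - x₂) / (α + β) := by
    rw [← p4]; field_simp; ring
  rw [f4, f3, e2]
  generalize α + β = t
  simp [Matrix.det_succ_row_zero, Fin.sum_univ_succ, Fin.succAbove]
  ring
end
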